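/- arXiv:0706.4298 — 10 statements merged into one kernel-verified Lean document; each statement's English description precedes it below -/
import Mathlib

section
/- Let ρ and δ be integers with 1 ≤ ρ ≤ δ, and define the virtual phase of p at time t as R_t(p) = ⌊ℓ_t p / δ⌋. Then for every t ∈ ℕ, every integer U, and all p, q ∈ V with d(p,q) ≤ ρ: if ℓ_t p ≥ (U+1)·δ then ℓ_t q ≥ (U+1)·δ − ρ ≥ U·δ; in particular R_t(p) ≥ U+1 implies R_t(q) ≥ U. Thus the integer-lifted unison execution solves barrier synchronization at distance ρ for the virtual δ-quotient clock: no process proceeds to phase U+1 before every process at distance at most ρ has entered phase U. -/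
/-- A map changing by at most one along each edge changes by at most the distance. -/
theorem SimpleGraph.Connected.abs_sub_le_dist {V : Type*} {G : SimpleGraph V}
    (hconn : G.Connected) {f : V → ℤ} (hf : ∀ p q, G.Adj p q → |f p - f q| ≤ 1) (p q : V) :
    |f p - f q| ≤ G.dist p q := by
  have walk_bound : ∀ {a b : V} (w : G.Walk a b), |f a - f b| ≤ w.length := by
    intro a b w
    induction w with
    | nil => simp
    | cons h w ih =>
      rw [SimpleGraph.Walk.length_cons, Nat.cast_succ, add_comm]
      exact (abs_sub_le _ _ _).trans (add_le_add (hf _ _ h) ih)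
  obtain ⟨w, hw⟩ := hconn.exists_walk_length_eq_dist p q
  exact hw ▸ walk_bound w

/-- Along a unison execution, clocks of neighbors always differ by at most one. -/
theorem unison_abs_sub_le_one {V : Type*} {G : SimpleGraph V} {ℓ : ℕ → V → ℤ} {A : ℕ → Set V}
    (hguard : ∀ t, ∀ p ∈ A t, ∀ q, G.Adj p q → ℓ t q = ℓ t p ∨ ℓ t q = ℓ t p + 1)
    (hfire : ∀ t, ∀ p ∈ A t, ℓ (t + 1) p = ℓ t p + 1)
    (hstay : ∀ t, ∀ p, p ∉ A t → ℓ (t + 1) p = ℓ t p)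
    (hinit : ∀ p q, G.Adj p q → |ℓ 0 p - ℓ 0 q| ≤ 1) (t : ℕ) (p q : V) (h : G.Adj p q) :
    |ℓ t p - ℓ t q| ≤ 1 := by
  induction t with
  | zero => exact hinit p q h
  | succ t ih =>
    rw [abs_le] at ih ⊢
    by_cases hp : p ∈ A t <;> by_cases hq : q ∈ A t
    · have := hfire t p hp
      have := hfire t q hq
      omega
    · have := hfire t p hp
      have := hstay t q hq
      have := hguard t p hp q h
      omega
    · have := hstay t p hp
      have := hfire t q hq
      have := hguard t q hq p h.symm
      omega
    · have := hstay t p hp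
      have := hstay t q hq
      omega

/-- Let `1 ≤ ρ ≤ δ` and let `R_t(p) = ⌊ℓ_t p / δ⌋` be the virtual
phase of `p` at time `t`.  Then for every `t : ℕ`, every integer `U` and all
processes `p, q` with `d(p,q) ≤ ρ`: if `ℓ_t p ≥ (U+1)·δ` then
`ℓ_t q ≥ (U+1)·δ − ρ ≥ U·δ`; in particular `R_t(p) ≥ U+1` implies
`R_t(q) ≥ U`.  Thus the integer-lifted unison execution solves barrier
synchronization at distance `ρ` for the virtual `δ`-quotient clock. -/
theorem stmt_0 {V : Type*} [Fintype V] (G : SimpleGraph V) (hconn : G.Connected)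
    (ℓ : ℕ → V → ℤ) (A : ℕ → Set V)
    (hA : ∀ t, (A t).Nonempty)
    (hguard : ∀ t, ∀ p ∈ A t, ∀ q, G.Adj p q → ℓ t q = ℓ t p ∨ ℓ t q = ℓ t p + 1)
    (hfire : ∀ t, ∀ p ∈ A t, ℓ (t + 1) p = ℓ t p + 1)
    (hstay : ∀ t, ∀ p, p ∉ A t → ℓ (t + 1) p = ℓ t p)
    (hinit : ∀ p q, G.Adj p q → |ℓ 0 p - ℓ 0 q| ≤ 1)
    (ρ δ : ℕ) (hρ : 1 ≤ ρ) (hρδ : ρ ≤ δ) :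
    ∀ t : ℕ, ∀ U : ℤ, ∀ p q : V, G.dist p q ≤ ρ →
      ((U + 1) * (δ : ℤ) ≤ ℓ t p →
        (U + 1) * (δ : ℤ) - (ρ : ℤ) ≤ ℓ t q ∧
        U * (δ : ℤ) ≤ (U + 1) * (δ : ℤ) - (ρ : ℤ)) ∧
      (U + 1 ≤ Int.fdiv (ℓ t p) (δ : ℤ) → U ≤ Int.fdiv (ℓ t q) (δ : ℤ)) := by
  intro t U p q hpq
  have hdist : |ℓ t p - ℓ t q| ≤ (ρ : ℤ) :=
    (hconn.abs_sub_le_dist (unison_abs_sub_le_one hguard hfire hstay hinit t) p q).trans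
      (by exact_mod_cast hpq)
  have hlag := (abs_le.mp hdist).2
  have hδ : (0 : ℤ) < δ := by omega
  have hphase : (U + 1) * (δ : ℤ) = U * δ + δ := by ring
  refine ⟨fun h => ⟨by omega, by omega⟩, fun h => ?_⟩
  rw [Int.fdiv_eq_ediv_of_nonneg _ hδ.le, Int.le_ediv_iff_mul_le hδ] at h ⊢
  omega
end

section
/- Let k ≥ max_{p∈V} ℓ_0 p and δ ≥ 1. Then the segment [C_k, C_{k+δ}], with the events (p, t_{p,k+δ}) as decide events, is a δ-wavelet: for every p ∈ V and every q ∈ V with d(p,q) ≤ δ, there exists a causal chain ending at (p, t_{p,k+δ}) that starts at some event (q, t') with t_{q,k} ≤ t', all of whose events (u, s) satisfy t_{u,k} ≤ s ≤ t_{u,k+δ}. In particular, when δ ≥ D (the diameter of G), the past cone of every decide event within the segment covers all of V, i.e. the segment is a wave. -/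
/-- `(p,0)` is an event for every `p`, and `(p,t+1)` is an event iff `p ∈ A t`. -/
def IsEvent {V : Type*} (A : ℕ → Set V) (p : V) (t : ℕ) : Prop :=
  t = 0 ∨ ∃ t', t = t' + 1 ∧ p ∈ A t'

/-- The causal relation `⇝` on events. -/
def Leadsto {V : Type*} (G : SimpleGraph V) (A : ℕ → Set V) (e f : V × ℕ) : Prop :=
  (e.1 = f.1 ∨ G.Adj e.1 f.1) ∧ IsEvent A f.1 f.2 ∧ 0 < f.2 ∧
    IsEvent A e.1 e.2 ∧ e.2 < f.2 ∧ ∀ s, e.2 < s → s < f.2 → ¬ IsEvent A e.1 s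

theorem unison_monotone {V : Type*} {ℓ : ℕ → V → ℤ} {A : ℕ → Set V}
    (hfire : ∀ t, ∀ p ∈ A t, ℓ (t + 1) p = ℓ t p + 1)
    (hstay : ∀ t, ∀ p, p ∉ A t → ℓ (t + 1) p = ℓ t p) (p : V) :
    Monotone fun t => ℓ t p := by
  refine monotone_nat_of_le_succ fun t => ?_
  by_cases h : p ∈ A t
  · simp [hfire t p h]
  · simp [hstay t p h]

/-- The first time a process reaches a level is an event. -/
theorem isEvent_of_first {V : Type*} {ℓ : ℕ → V → ℤ} {A : ℕ → Set V}
    (hstay : ∀ t, ∀ p, p ∉ A t → ℓ (t + 1) p = ℓ t p) {p : V} {m : ℤ} {t : ℕ}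
    (ht : ℓ t p = m) (hmin : ∀ s, ℓ s p = m → t ≤ s) : IsEvent A p t := by
  rcases t with _ | s
  · exact Or.inl rfl
  · refine Or.inr ⟨s, rfl, ?_⟩
    by_contra h
    have := hmin s (by rw [← hstay s p h, ht])
    omega

/-- A process does not fire between first reaching its current level and now. -/
theorem not_isEvent_of_level_eq {V : Type*} {ℓ : ℕ → V → ℤ} {A : ℕ → Set V}
    (hfire : ∀ t, ∀ p ∈ A t, ℓ (t + 1) p = ℓ t p + 1)
    (hmono : ∀ p, Monotone fun t => ℓ t p) {p : V} {a b r : ℕ}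
    (h : ℓ a p = ℓ b p) (har : a < r) (hrb : r ≤ b) : ¬ IsEvent A p r := by
  rintro (rfl | ⟨r, rfl, hr⟩)
  · omega
  · have h1 : ℓ a p ≤ ℓ r p := hmono p (by omega)
    have h2 : ℓ (r + 1) p ≤ ℓ b p := hmono p hrb
    have h3 := hfire r p hr
    omega

/-- A causal chain inside the segment `[C_k, C_m]` exists from any process at distance at most
`n` to the event at which `p` first reaches level `m ≥ k + n`. -/
theorem exists_causal_chain {V : Type*} {G : SimpleGraph V} (hconn : G.Connected)
    {ℓ : ℕ → V → ℤ} {A : ℕ → Set V}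
    (hguard : ∀ t, ∀ p ∈ A t, ∀ q, G.Adj p q → ℓ t q = ℓ t p ∨ ℓ t q = ℓ t p + 1)
    (hfire : ∀ t, ∀ p ∈ A t, ℓ (t + 1) p = ℓ t p + 1)
    (hstay : ∀ t, ∀ p, p ∉ A t → ℓ (t + 1) p = ℓ t p)
    {k : ℤ} (hk : ∀ p : V, ℓ 0 p ≤ k) {T : ℤ → V → ℕ}
    (hT : ∀ (m : ℤ) (p : V), k ≤ m →
      ℓ (T m p) p = m ∧ ∀ t, ℓ t p = m → T m p ≤ t)
    (q : V) (n : ℕ) : ∀ (p : V) (m : ℤ), k + n ≤ m → G.dist q p ≤ n →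
      ∃ C : List (V × ℕ), C ≠ [] ∧ List.IsChain (Leadsto G A) C ∧
        C.getLast? = some (p, T m p) ∧
        (∃ t', T k q ≤ t' ∧ C.head? = some (q, t')) ∧
        ∀ e ∈ C, T k e.1 ≤ e.2 ∧ e.2 ≤ T m e.1 := by
  have hmono := unison_monotone hfire hstay
  have hTmono : ∀ (a b : ℤ) (u : V), k ≤ a → a ≤ b → T a u ≤ T b u := by
    intro a b u ha hab
    obtain ⟨ha1, ha2⟩ := hT a u ha
    obtain ⟨hb1, -⟩ := hT b u (ha.trans hab)
    by_contra! hlt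
    have h : ℓ (T b u) u ≤ ℓ (T a u) u := hmono u hlt.le
    have := ha2 (T b u) (by omega)
    omega
  induction n with
  | zero =>
    intro p m hm hd
    obtain rfl : q = p := (hconn.dist_eq_zero_iff).1 (by omega)
    have h := hTmono k m q le_rfl (by simpa using hm)
    exact ⟨[(q, T m q)], by simp, by simp, by simp, ⟨_, h, rfl⟩, by simpa using h⟩
  | succ n ih =>
    intro p m hm hd
    push_cast at hm
    rcases Nat.lt_or_ge n (G.dist q p) with hlt | hle
    swap
    · exact ih p m (by omega) hle
    obtain ⟨u, hup, hqu⟩ : ∃ u, G.Adj p u ∧ G.dist q u ≤ n := by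
      obtain ⟨w, hw⟩ := hconn.exists_walk_length_eq_dist p q
      cases w with
      | nil => simp at hlt
      | cons h w =>
        refine ⟨_, h, ?_⟩
        rw [SimpleGraph.dist_comm] at hd ⊢
        have := SimpleGraph.dist_le w
        simp only [SimpleGraph.Walk.length_cons] at hw
        omega
    obtain ⟨hm1, hm2⟩ := hT m p (by omega)
    have hev := isEvent_of_first hstay hm1 hm2
    obtain h0 | ⟨s, hs, hps⟩ := id hev
    · have := hk p
      rw [h0] at hm1
      omega
    have hlev := hfire s p hps
    rw [← hs, hm1] at hlev
    have hu := hguard s p hps u hup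
    have hku : k + n ≤ ℓ s u := by omega
    obtain ⟨hu1, hu2⟩ := hT (ℓ s u) u (by omega)
    have hus := hu2 s rfl
    have hstep : Leadsto G A (u, T (ℓ s u) u) (p, T m p) :=
      ⟨Or.inr hup.symm, hev, by simp [hs], isEvent_of_first hstay hu1 hu2,
        by simp only; omega, fun r hr1 hr2 =>
          not_isEvent_of_level_eq hfire hmono hu1 hr1 (by simp only at hr2; omega)⟩
    obtain ⟨C, hC, hchain, hlast, ⟨t', ht', hhead⟩, hmem⟩ := ih u (ℓ s u) hku hqu
    refine ⟨C ++ [(p, T m p)], by simp, ?_, by simp, ⟨t', ht', ?_⟩, ?_⟩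
    · refine List.isChain_append.2 ⟨hchain, by simp, ?_⟩
      intro x hx y hy
      rw [hlast] at hx
      simp only [Option.mem_def, Option.some.injEq, List.head?_cons] at hx hy
      subst hx hy
      exact hstep
    · simp [List.head?_append, hhead]
    · intro e he
      rcases List.mem_append.1 he with he | he
      · exact ⟨(hmem e he).1,
          (hmem e he).2.trans (hTmono _ _ _ (by omega) (by omega))⟩
      · obtain rfl := List.mem_singleton.1 he
        exact ⟨hTmono _ _ _ le_rfl (by omega), le_rfl⟩

/-- Let `k ≥ max_{p∈V} ℓ_0 p` and `δ ≥ 1`.  Then the segment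
`[C_k, C_{k+δ}]`, with the events `(p, t_{p,k+δ})` as decide events, is a
`δ`-wavelet: for every `p` and every `q` with `d(p,q) ≤ δ`, there is a causal
chain ending at `(p, t_{p,k+δ})`, starting at some event `(q,t')` with
`t_{q,k} ≤ t'`, all of whose events `(u,s)` satisfy `t_{u,k} ≤ s ≤ t_{u,k+δ}`.
In particular, when `δ ≥ D` (the diameter of `G`), the past cone of every
decide event within the segment covers all of `V`: the segment is a wave. -/
theorem stmt_1 {V : Type*} [Fintype V] (G : SimpleGraph V) (hconn : G.Connected)
    (ℓ : ℕ → V → ℤ) (A : ℕ → Set V)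
    (hA : ∀ t, (A t).Nonempty)
    (hguard : ∀ t, ∀ p ∈ A t, ∀ q, G.Adj p q → ℓ t q = ℓ t p ∨ ℓ t q = ℓ t p + 1)
    (hfire : ∀ t, ∀ p ∈ A t, ℓ (t + 1) p = ℓ t p + 1)
    (hstay : ∀ t, ∀ p, p ∉ A t → ℓ (t + 1) p = ℓ t p)
    (hinit : ∀ p q, G.Adj p q → |ℓ 0 p - ℓ 0 q| ≤ 1)
    (hfair : ∀ (p : V) (t : ℕ), ∃ t', t ≤ t' ∧ p ∈ A t')
    (k : ℤ) (hk : ∀ p : V, ℓ 0 p ≤ k)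
    (δ : ℕ) (hδ : 1 ≤ δ)
    (T : ℤ → V → ℕ)
    (hT : ∀ (m : ℤ) (p : V), k ≤ m →
      ℓ (T m p) p = m ∧ ∀ t, ℓ t p = m → T m p ≤ t) :
    (∀ p q : V, G.dist q p ≤ δ →
      ∃ C : List (V × ℕ), C ≠ [] ∧ List.Chain' (Leadsto G A) C ∧
        C.getLast? = some (p, T (k + δ) p) ∧
        (∃ t', T k q ≤ t' ∧ C.head? = some (q, t')) ∧
        ∀ e ∈ C, T k e.1 ≤ e.2 ∧ e.2 ≤ T (k + δ) e.1) ∧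
    (G.diam ≤ δ →
      ∀ p q : V, ∃ C : List (V × ℕ), C ≠ [] ∧ List.Chain' (Leadsto G A) C ∧
        C.getLast? = some (p, T (k + δ) p) ∧
        (∃ t', T k q ≤ t' ∧ C.head? = some (q, t')) ∧
        ∀ e ∈ C, T k e.1 ≤ e.2 ∧ e.2 ≤ T (k + δ) e.1) := by
  have main := fun p q hd => exists_causal_chain hconn hguard hfire hstay hk hT q δ p (k + δ)
    le_rfl hd
  refine ⟨main, fun hdiam p q => main p q ?_⟩
  have := hconn.nonempty
  exact (SimpleGraph.dist_le_diam (SimpleGraph.connected_iff_ediam_ne_top.1 hconn)).trans hdiam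
end

section
/- Let k ≥ max_{p∈V} ℓ_0 p and let δ be at least the maximal length of a simple walk in G. Then the segment [C_k, C_{k+δ}] is a strong wave: for every p ∈ V and every simple walk m₀ ending at p, there exists a causal chain (q_0,t_0) ⇝ (q_1,t_1) ⇝ … ⇝ (q_r,t_r) = (p, t_{p,k+δ}), all of whose events (u,s) satisfy t_{u,k} ≤ s ≤ t_{u,k+δ}, whose associated walk m = q_0 q_1 … q_r is elementary and satisfies m →* m₀. -/
/-- A walk in `G`. -/
def IsWalk {V : Type*} (G : SimpleGraph V) (m : List V) : Prop :=
  m ≠ [] ∧ m.Chain' (fun a b => a = b ∨ G.Adj a b)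

/-- A circular walk. -/
def IsCircular {V : Type*} (G : SimpleGraph V) (u : List V) : Prop :=
  IsWalk G u ∧ 2 ≤ u.length ∧ u.head? = u.getLast?

/-- One step of the rewriting relation on walks. -/
def StepRw {V : Type*} (G : SimpleGraph V) (m m' : List V) : Prop :=
  ∃ (m₁ u m₂ : List V) (h : V), IsCircular G u ∧ u.head? = some h ∧
    m = m₁ ++ u ++ m₂ ∧ m' = m₁ ++ [h] ++ m₂

/-- `m →* m'`. -/
def RwStar {V : Type*} (G : SimpleGraph V) : List V → List V → Prop :=
  Relation.ReflTransGen (StepRw G)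

/-- An elementary walk. -/
def Elementary {V : Type*} (m : List V) : Prop :=
  ∀ i j k : ℕ, i ≤ k → k ≤ j → j < m.length → m[i]? = m[j]? → m[k]? = m[i]?

theorem Elementary.of_nodup {V : Type*} {m : List V} (h : m.Nodup) : Elementary m := by
  intro i j k hik hkj hj hij
  have : i = j := (h.getElem_inj_iff (hi := by omega) (hj := hj)).1 (by
    rwa [List.getElem?_eq_getElem (by omega), List.getElem?_eq_getElem hj,
      Option.some.injEq] at hij)
  obtain rfl : k = i := by omega
  rfl

section Unison

variable {V : Type*} {ℓ : ℕ → V → ℤ} {A : ℕ → Set V}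

theorem level_monotone (hfire : ∀ t, ∀ p ∈ A t, ℓ (t + 1) p = ℓ t p + 1)
    (hstay : ∀ t, ∀ p, p ∉ A t → ℓ (t + 1) p = ℓ t p) (p : V) :
    Monotone fun t => ℓ t p := by
  refine monotone_nat_of_le_succ fun t => ?_
  by_cases h : p ∈ A t
  · simp [hfire t p h]
  · simp [hstay t p h]

/-- If `τ` is the first time at which `q` has its level at time `t`, then `(q, τ)` is the last
event of `q` up to time `t`. -/
theorem isLastEvent_of_first_time (hfire : ∀ t, ∀ p ∈ A t, ℓ (t + 1) p = ℓ t p + 1)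
    (hstay : ∀ t, ∀ p, p ∉ A t → ℓ (t + 1) p = ℓ t p) {q : V} {t τ : ℕ}
    (hτ : ℓ τ q = ℓ t q) (hmin : ∀ s, ℓ s q = ℓ t q → τ ≤ s) :
    IsEvent A q τ ∧ τ ≤ t ∧ ∀ s, τ < s → s < t + 1 → ¬ IsEvent A q s := by
  refine ⟨?_, hmin t rfl, ?_⟩
  · rcases τ with _ | τ
    · exact Or.inl rfl
    · refine Or.inr ⟨τ, rfl, ?_⟩
      by_contra h
      have := hmin τ (by rw [← hτ, hstay τ q h])
      omega
  · rintro s hs hst (rfl | ⟨s, rfl, hq⟩)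
    · omega
    · have h₁ : ℓ τ q ≤ ℓ s q := level_monotone hfire hstay q (by omega)
      have h₂ : ℓ (s + 1) q ≤ ℓ t q := level_monotone hfire hstay q (by omega)
      have := hfire s q hq
      omega

variable {G : SimpleGraph V} {k : ℤ} {T : ℤ → V → ℕ}

theorem first_time_mono (hfire : ∀ t, ∀ p ∈ A t, ℓ (t + 1) p = ℓ t p + 1)
    (hstay : ∀ t, ∀ p, p ∉ A t → ℓ (t + 1) p = ℓ t p)
    (hT : ∀ (m : ℤ) (p : V), k ≤ m → ℓ (T m p) p = m ∧ ∀ t, ℓ t p = m → T m p ≤ t)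
    {i j : ℤ} (hi : k ≤ i) (hij : i ≤ j) (p : V) : T i p ≤ T j p := by
  rcases hij.eq_or_lt with rfl | hlt
  · exact le_rfl
  · by_contra! h
    have : ℓ (T j p) p ≤ ℓ (T i p) p := level_monotone hfire hstay p h.le
    rw [(hT i p hi).1, (hT j p (hi.trans hij)).1] at this
    omega

theorem exists_leadsto_first_time
    (hguard : ∀ t, ∀ p ∈ A t, ∀ q, G.Adj p q → ℓ t q = ℓ t p ∨ ℓ t q = ℓ t p + 1)
    (hfire : ∀ t, ∀ p ∈ A t, ℓ (t + 1) p = ℓ t p + 1)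
    (hstay : ∀ t, ∀ p, p ∉ A t → ℓ (t + 1) p = ℓ t p) (hk : ∀ p : V, ℓ 0 p ≤ k)
    (hT : ∀ (m : ℤ) (p : V), k ≤ m → ℓ (T m p) p = m ∧ ∀ t, ℓ t p = m → T m p ≤ t)
    {p q : V} (hqp : q = p ∨ G.Adj q p) {j : ℤ} (hj : k < j) :
    ∃ i, j - 1 ≤ i ∧ i ≤ j ∧ Leadsto G A (q, T i q) (p, T j p) := by
  obtain ⟨hp, hmin⟩ := hT j p hj.le
  rcases hτ : T j p with _ | t
  · rw [hτ] at hp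
    have := hk p
    omega
  rw [hτ] at hp hmin
  have hpA : p ∈ A t := by
    by_contra h
    have := hmin t (by rw [← hp, hstay t p h])
    omega
  have hpt : ℓ t p = j - 1 := by
    have := hfire t p hpA
    omega
  have hqt : ℓ t q = j - 1 ∨ ℓ t q = j := by
    rcases hqp with rfl | hadj
    · exact Or.inl hpt
    · have := hguard t p hpA q hadj.symm
      omega
  obtain ⟨hq, hqmin⟩ := hT (ℓ t q) q (by omega)
  obtain ⟨hev, hle, hlast⟩ := isLastEvent_of_first_time hfire hstay hq hqmin
  exact ⟨ℓ t q, by omega, by omega, hqp, Or.inr ⟨t, rfl, hpA⟩, Nat.succ_pos t, hev,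
    Nat.lt_succ_of_le hle, hlast⟩

/-- A walk of length `r` ending at `p` lifts to a causal chain of first-time events ending at level
`j` of `p`, provided `k + r ≤ j`. -/
theorem exists_causal_chain_of_walk
    (hguard : ∀ t, ∀ p ∈ A t, ∀ q, G.Adj p q → ℓ t q = ℓ t p ∨ ℓ t q = ℓ t p + 1)
    (hfire : ∀ t, ∀ p ∈ A t, ℓ (t + 1) p = ℓ t p + 1)
    (hstay : ∀ t, ∀ p, p ∉ A t → ℓ (t + 1) p = ℓ t p) (hk : ∀ p : V, ℓ 0 p ≤ k)
    (hT : ∀ (m : ℤ) (p : V), k ≤ m → ℓ (T m p) p = m ∧ ∀ t, ℓ t p = m → T m p ≤ t)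
    (m : List V) {p : V} {j : ℤ} (hm : IsWalk G (m ++ [p])) (hj : k + m.length ≤ j) :
    ∃ C : List (V × ℕ), List.IsChain (Leadsto G A) (C ++ [(p, T j p)]) ∧ C.map Prod.fst = m ∧
      ∀ e ∈ C, ∃ i, k ≤ i ∧ i ≤ j ∧ e.2 = T i e.1 := by
  induction m using List.reverseRecOn generalizing p j with
  | nil => exact ⟨[], by simp, rfl, by simp⟩
  | append_singleton m q ih =>
    have hchain : List.IsChain (fun a b => a = b ∨ G.Adj a b) (m ++ [q] ++ [p]) := hm.2
    rw [List.isChain_append] at hchain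
    obtain ⟨hmq, -, hlast⟩ := hchain
    have hqp : q = p ∨ G.Adj q p := hlast q (by simp) p (by simp)
    rw [List.length_append, List.length_singleton] at hj
    push_cast at hj
    obtain ⟨i, hi, hij, hlead⟩ :=
      exists_leadsto_first_time hguard hfire hstay hk hT hqp (j := j) (by omega)
    obtain ⟨C, hC, hmap, hlev⟩ := ih (p := q) (j := i) ⟨by simp, hmq⟩ (by omega)
    refine ⟨C ++ [(q, T i q)], ?_, by simp [hmap], ?_⟩
    · rw [List.isChain_append]
      refine ⟨hC, by simp, ?_⟩
      simpa using hlead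
    · intro e he
      rcases List.mem_append.1 he with he | he
      · obtain ⟨i', h₁, h₂, h₃⟩ := hlev e he
        exact ⟨i', h₁, h₂.trans hij, h₃⟩
      · obtain rfl := List.mem_singleton.1 he
        exact ⟨i, by omega, hij, rfl⟩

end Unison

/-- Let `k ≥ max_{p∈V} ℓ_0 p` and let `δ` be at least the maximal
length of a simple walk in `G` (a simple walk given by a list of `r+1` distinct
vertices has length `r`).  Then the segment `[C_k, C_{k+δ}]` is a strong wave:
for every `p ∈ V` and every simple walk `m₀` ending at `p`, there exists a
causal chain `(q₀,t₀) ⇝ … ⇝ (q_r,t_r) = (p, t_{p,k+δ})`, all of whose events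
`(u,s)` satisfy `t_{u,k} ≤ s ≤ t_{u,k+δ}`, whose associated walk
`m = q₀q₁…q_r` is elementary and satisfies `m →* m₀`. -/
theorem stmt_2 {V : Type*} [Fintype V] (G : SimpleGraph V) (hconn : G.Connected)
    (ℓ : ℕ → V → ℤ) (A : ℕ → Set V)
    (hA : ∀ t, (A t).Nonempty)
    (hguard : ∀ t, ∀ p ∈ A t, ∀ q, G.Adj p q → ℓ t q = ℓ t p ∨ ℓ t q = ℓ t p + 1)
    (hfire : ∀ t, ∀ p ∈ A t, ℓ (t + 1) p = ℓ t p + 1)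
    (hstay : ∀ t, ∀ p, p ∉ A t → ℓ (t + 1) p = ℓ t p)
    (hinit : ∀ p q, G.Adj p q → |ℓ 0 p - ℓ 0 q| ≤ 1)
    (hfair : ∀ (p : V) (t : ℕ), ∃ t', t ≤ t' ∧ p ∈ A t')
    (k : ℤ) (hk : ∀ p : V, ℓ 0 p ≤ k)
    (δ : ℕ) (hδ : ∀ m : List V, IsWalk G m → m.Nodup → m.length ≤ δ + 1)
    (T : ℤ → V → ℕ)
    (hT : ∀ (m : ℤ) (p : V), k ≤ m →
      ℓ (T m p) p = m ∧ ∀ t, ℓ t p = m → T m p ≤ t) :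
    ∀ (p : V) (m₀ : List V), IsWalk G m₀ → m₀.Nodup → m₀.getLast? = some p →
      ∃ C : List (V × ℕ), C ≠ [] ∧ List.Chain' (Leadsto G A) C ∧
        C.getLast? = some (p, T (k + δ) p) ∧
        (∀ e ∈ C, T k e.1 ≤ e.2 ∧ e.2 ≤ T (k + δ) e.1) ∧
        Elementary (C.map Prod.fst) ∧ RwStar G (C.map Prod.fst) m₀ := by
  intro p m₀ hwalk hnodup hlast
  obtain ⟨m, rfl⟩ := List.getLast?_eq_some_iff.1 hlast
  have hlen := hδ _ hwalk hnodup
  rw [List.length_append, List.length_singleton] at hlen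
  obtain ⟨C, hC, rfl, hlev⟩ := exists_causal_chain_of_walk hguard hfire hstay hk hT m
    (j := k + δ) hwalk (by omega)
  have hmap : (C ++ [(p, T (k + δ) p)]).map Prod.fst = C.map Prod.fst ++ [p] := by simp
  refine ⟨C ++ [(p, T (k + δ) p)], by simp, hC, by simp, ?_, ?_, ?_⟩
  · intro e he
    have : ∃ i, k ≤ i ∧ i ≤ k + δ ∧ e.2 = T i e.1 := by
      rcases List.mem_append.1 he with he | he
      · exact hlev e he
      · obtain rfl := List.mem_singleton.1 he
        exact ⟨k + δ, by omega, le_rfl, rfl⟩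
    obtain ⟨i, hi, hij, h⟩ := this
    rw [h]
    exact ⟨first_time_mono hfire hstay hT le_rfl hi e.1, first_time_mono hfire hstay hT hi hij e.1⟩
  · rw [hmap]
    exact Elementary.of_nodup hnodup
  · rw [hmap]
    exact Relation.ReflTransGen.refl
end

section
/- If (p,t) ⇝ (q,t') then ℓ_{t'} q ∈ {ℓ_t p, ℓ_t p + 1}. Inductively, if (q_0,t_0) ⇝ (q_1,t_1) ⇝ … ⇝ (q_i,t_i) is a causal chain, then ℓ_{t_i} q_i ∈ {ℓ_{t_0} q_0, ℓ_{t_0} q_0 + 1, …, ℓ_{t_0} q_0 + i}. -/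
/-- The clock of `p` is constant on a time interval containing no event of `p` but its start. -/
lemma clock_eq_of_no_event {V : Type*} {ℓ : ℕ → V → ℤ} {A : ℕ → Set V}
    (hstay : ∀ t, ∀ p, p ∉ A t → ℓ (t + 1) p = ℓ t p) {p : V} {t u : ℕ} (htu : t ≤ u)
    (hno : ∀ s, t < s → s ≤ u → ¬ IsEvent A p s) : ℓ u p = ℓ t p := by
  induction u, htu using Nat.le_induction with
  | base => rfl
  | succ n hn ih =>
    rw [hstay n p fun hp => hno (n + 1) (by omega) le_rfl (Or.inr ⟨n, rfl, hp⟩)]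
    exact ih fun s h1 h2 => hno s h1 (by omega)

/-- One causal step raises the clock by `0` or `1`. -/
lemma Leadsto.clock_eq_or {V : Type*} {G : SimpleGraph V} {ℓ : ℕ → V → ℤ} {A : ℕ → Set V}
    (hguard : ∀ t, ∀ p ∈ A t, ∀ q, G.Adj p q → ℓ t q = ℓ t p ∨ ℓ t q = ℓ t p + 1)
    (hfire : ∀ t, ∀ p ∈ A t, ℓ (t + 1) p = ℓ t p + 1)
    (hstay : ∀ t, ∀ p, p ∉ A t → ℓ (t + 1) p = ℓ t p)
    {e f : V × ℕ} (h : Leadsto G A e f) :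
    ℓ f.2 f.1 = ℓ e.2 e.1 ∨ ℓ f.2 f.1 = ℓ e.2 e.1 + 1 := by
  obtain ⟨p, t⟩ := e
  obtain ⟨q, t'⟩ := f
  obtain ⟨hpq, hq, hpos, -, hlt, hno⟩ := h
  dsimp only at *
  obtain rfl | ⟨s, rfl, hqs⟩ := hq
  · omega
  have hconst : ℓ s p = ℓ t p :=
    clock_eq_of_no_event hstay (by omega) fun u h1 h2 => hno u h1 (by omega)
  have hq_succ := hfire s q hqs
  obtain rfl | hadj := hpq
  · omega
  · have := hguard s q hqs p hadj.symm
    omega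

/-- If each step of a chain raises `f` by `0` or `1`, then the total increase is a natural number
at most the number of steps. -/
lemma exists_add_natCast_of_isChain {α : Type*} {R : α → α → Prop} {f : α → ℤ}
    (hR : ∀ a b, R a b → f b = f a ∨ f b = f a + 1) {C : List α} (hC : C.IsChain R) {a b : α}
    (ha : C.head? = some a) (hb : C.getLast? = some b) :
    ∃ j : ℕ, j + 1 ≤ C.length ∧ f b = f a + (j : ℤ) := by
  induction C generalizing a with
  | nil => simp at ha
  | cons x l ih =>
    obtain rfl : x = a := by simpa using ha
    cases l with
    | nil =>
      obtain rfl : x = b := by simpa using hb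
      exact ⟨0, by simp⟩
    | cons y l =>
      rw [List.isChain_cons_cons] at hC
      obtain ⟨j, hj, hbj⟩ := ih hC.2 rfl (by simpa using hb)
      simp only [List.length_cons] at hj ⊢
      obtain h | h := hR x y hC.1
      · exact ⟨j, by omega, by omega⟩
      · exact ⟨j + 1, by omega, by push_cast; omega⟩

/-- If `(p,t) ⇝ (q,t')` then `ℓ_{t'} q ∈ {ℓ_t p, ℓ_t p + 1}`.
Inductively, along any causal chain `(q_0,t_0) ⇝ … ⇝ (q_i,t_i)` (of `i` steps,
i.e. a list of `i+1` events related by consecutive `⇝` steps),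
`ℓ_{t_i} q_i ∈ {ℓ_{t_0} q_0, …, ℓ_{t_0} q_0 + i}`. -/
theorem stmt_5 {V : Type*} [Fintype V] (G : SimpleGraph V) (hconn : G.Connected)
    (ℓ : ℕ → V → ℤ) (A : ℕ → Set V)
    (hA : ∀ t, (A t).Nonempty)
    (hguard : ∀ t, ∀ p ∈ A t, ∀ q, G.Adj p q → ℓ t q = ℓ t p ∨ ℓ t q = ℓ t p + 1)
    (hfire : ∀ t, ∀ p ∈ A t, ℓ (t + 1) p = ℓ t p + 1)
    (hstay : ∀ t, ∀ p, p ∉ A t → ℓ (t + 1) p = ℓ t p)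
    (hinit : ∀ p q, G.Adj p q → |ℓ 0 p - ℓ 0 q| ≤ 1) :
    (∀ p t q t', Leadsto G A (p, t) (q, t') →
        ℓ t' q = ℓ t p ∨ ℓ t' q = ℓ t p + 1) ∧
    (∀ C : List (V × ℕ), C ≠ [] → List.Chain' (Leadsto G A) C →
      ∀ e₀ e₁ : V × ℕ, C.head? = some e₀ → C.getLast? = some e₁ →
        ∃ j : ℕ, j + 1 ≤ C.length ∧ ℓ e₁.2 e₁.1 = ℓ e₀.2 e₀.1 + (j : ℤ)) := by
  have hstep : ∀ e f, Leadsto G A e f →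
      ℓ f.2 f.1 = ℓ e.2 e.1 ∨ ℓ f.2 f.1 = ℓ e.2 e.1 + 1 :=
    fun _ _ h => h.clock_eq_or hguard hfire hstay
  exact ⟨fun p t q t' h => hstep (p, t) (q, t') h, fun C _ hC e₀ e₁ h₀ h₁ =>
    exists_add_natCast_of_isChain (f := fun e : V × ℕ => ℓ e.2 e.1) hstep hC h₀ h₁⟩
end

section
/- In every integer-lifted unison execution, every process fires infinitely often (the no-lockout property): for all p ∈ V and all T ∈ ℕ there exists t ≥ T with p ∈ A_t. Moreover, at every time t, any process p whose value ℓ_t p is minimal among all processes satisfies the guard, so some process is always enabled. -/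
/-- Along a walk, a function that varies by at most one across edges grows by at most the length
of the walk. -/
theorem SimpleGraph.Walk.le_add_length {V : Type*} {G : SimpleGraph V} {f : V → ℤ}
    (hf : ∀ p q, G.Adj p q → |f p - f q| ≤ 1) {p q : V} (w : G.Walk p q) :
    f q ≤ f p + w.length := by
  induction w with
  | nil => simp
  | cons h w ih =>
    have := abs_le.mp (hf _ _ h)
    rw [SimpleGraph.Walk.length_cons]
    push_cast
    linarith

/-- A step of unison preserves the property that neighbouring clocks differ by at most one. -/
theorem abs_sub_le_one_of_unison_step {V : Type*} {G : SimpleGraph V} {f g : V → ℤ} {S : Set V}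
    (hguard : ∀ p ∈ S, ∀ q, G.Adj p q → f q = f p ∨ f q = f p + 1)
    (hfire : ∀ p ∈ S, g p = f p + 1) (hstay : ∀ p, p ∉ S → g p = f p)
    (hf : ∀ p q, G.Adj p q → |f p - f q| ≤ 1) (p q : V) (hpq : G.Adj p q) :
    |g p - g q| ≤ 1 := by
  have h := abs_le.mp (hf p q hpq)
  rw [abs_le]
  by_cases hp : p ∈ S <;> by_cases hq : q ∈ S
  · have := hfire p hp
    have := hfire q hq
    omega
  · have := hfire p hp
    have := hstay q hq
    have := hguard p hp q hpq
    omega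
  · have := hstay p hp
    have := hfire q hq
    have := hguard q hq p hpq.symm
    omega
  · have := hstay p hp
    have := hstay q hq
    omega

/-- If at every time some process fires, the sum of all clocks grows by at least one per step. -/
theorem sum_add_le_sum_of_unison {V : Type*} [Fintype V] {ℓ : ℕ → V → ℤ} {A : ℕ → Set V}
    (hA : ∀ t, (A t).Nonempty) (hfire : ∀ t, ∀ p ∈ A t, ℓ (t + 1) p = ℓ t p + 1)
    (hstay : ∀ t, ∀ p, p ∉ A t → ℓ (t + 1) p = ℓ t p) (T n : ℕ) :
    ∑ v, ℓ T v + n ≤ ∑ v, ℓ (T + n) v := by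
  induction n with
  | zero => simp
  | succ n ih =>
    have hlt : ∑ v, ℓ (T + n) v < ∑ v, ℓ (T + n + 1) v := by
      obtain ⟨p, hp⟩ := hA (T + n)
      refine Finset.sum_lt_sum (fun q _ => ?_) ⟨p, Finset.mem_univ p, ?_⟩
      · by_cases hq : q ∈ A (T + n)
        · have := hfire _ q hq
          omega
        · exact (hstay _ q hq).ge
      · have := hfire _ p hp
        omega
    rw [← Nat.add_assoc]
    push_cast
    omega


/-- In every integer-lifted unison execution, every process fires
infinitely often (no lockout); moreover, at every time `t`, any process whose
value `ℓ_t p` is minimal among all processes satisfies the guard, so some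
process is always enabled. -/
theorem stmt_6 {V : Type*} [Fintype V] (G : SimpleGraph V) (hconn : G.Connected)
    (ℓ : ℕ → V → ℤ) (A : ℕ → Set V)
    (hA : ∀ t, (A t).Nonempty)
    (hguard : ∀ t, ∀ p ∈ A t, ∀ q, G.Adj p q → ℓ t q = ℓ t p ∨ ℓ t q = ℓ t p + 1)
    (hfire : ∀ t, ∀ p ∈ A t, ℓ (t + 1) p = ℓ t p + 1)
    (hstay : ∀ t, ∀ p, p ∉ A t → ℓ (t + 1) p = ℓ t p)
    (hinit : ∀ p q, G.Adj p q → |ℓ 0 p - ℓ 0 q| ≤ 1) :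
    (∀ p : V, ∀ T : ℕ, ∃ t, T ≤ t ∧ p ∈ A t) ∧
    (∀ t, ∀ p : V, (∀ q : V, ℓ t p ≤ ℓ t q) →
      ∀ q, G.Adj p q → ℓ t q = ℓ t p ∨ ℓ t q = ℓ t p + 1) ∧
    (∀ t, ∃ p : V, ∀ q, G.Adj p q → ℓ t q = ℓ t p ∨ ℓ t q = ℓ t p + 1) := by
  have hinv : ∀ t p q, G.Adj p q → |ℓ t p - ℓ t q| ≤ 1 := by
    intro t
    induction t with
    | zero => exact hinit
    | succ t ih => exact abs_sub_le_one_of_unison_step (hguard t) (hfire t) (hstay t) ih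
  have hmin : ∀ t, ∀ p : V, (∀ q : V, ℓ t p ≤ ℓ t q) →
      ∀ q, G.Adj p q → ℓ t q = ℓ t p ∨ ℓ t q = ℓ t p + 1 := by
    intro t p hp q hpq
    have h₁ := abs_le.mp (hinv t p q hpq)
    have h₂ := hp q
    omega
  refine ⟨fun p T => ?_, hmin, fun t => ?_⟩
  · by_contra! hno
    have hconst : ∀ n, ℓ (T + n) p = ℓ T p := by
      intro n
      induction n with
      | zero => rfl
      | succ n ih => rw [← Nat.add_assoc, hstay _ p (hno _ (Nat.le_add_right T n)), ih]
    have hbound : ∀ n, ∑ v, ℓ (T + n) v ≤ ∑ v, (ℓ T p + G.dist p v) := by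
      refine fun n => Finset.sum_le_sum fun v _ => ?_
      obtain ⟨w, hw⟩ := hconn.exists_walk_length_eq_dist p v
      rw [← hconst n, ← hw]
      exact w.le_add_length (hinv _)
    obtain ⟨n, hn⟩ := exists_nat_gt (∑ v, (ℓ T p + G.dist p v) - ∑ v, ℓ T v)
    have h₁ := hbound n
    have h₂ := sum_add_le_sum_of_unison hA hfire hstay T n
    linarith
  · have := hconn.nonempty
    obtain ⟨p, hp⟩ := Finite.exists_min (ℓ t)
    exact ⟨p, hmin t p hp⟩
end

section
/- For every t ∈ ℕ and every edge {p,q} ∈ E, |ℓ_t p − ℓ_t q| ≤ 1. That is, the predicate WU_0 (neighboring lifted clock values differ by at most 1) is closed under the unison guarded action. -/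
/-- In every integer-lifted unison execution, at every time `t`,
neighboring lifted clock values differ by at most 1: the predicate `WU₀` is
closed under the unison guarded action. -/
theorem stmt_7 {V : Type*} [Fintype V] (G : SimpleGraph V) (hconn : G.Connected)
    (ℓ : ℕ → V → ℤ) (A : ℕ → Set V)
    (hA : ∀ t, (A t).Nonempty)
    (hguard : ∀ t, ∀ p ∈ A t, ∀ q, G.Adj p q → ℓ t q = ℓ t p ∨ ℓ t q = ℓ t p + 1)
    (hfire : ∀ t, ∀ p ∈ A t, ℓ (t + 1) p = ℓ t p + 1)
    (hstay : ∀ t, ∀ p, p ∉ A t → ℓ (t + 1) p = ℓ t p)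
    (hinit : ∀ p q, G.Adj p q → |ℓ 0 p - ℓ 0 q| ≤ 1) :
    ∀ t, ∀ p q, G.Adj p q → |ℓ t p - ℓ t q| ≤ 1 := by
  intro t
  induction t with
  | zero => exact hinit
  | succ t ih =>
    intro p q hpq
    have h := abs_le.mp (ih p q hpq)
    rw [abs_le]
    by_cases hp : p ∈ A t <;> by_cases hq : q ∈ A t
    · rw [hfire t p hp, hfire t q hq]
      omega
    · have hg := hguard t p hp q hpq
      rw [hfire t p hp, hstay t q hq]
      omega
    · have hg := hguard t q hq p hpq.symm
      rw [hstay t p hp, hfire t q hq]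
      omega
    · rw [hstay t p hp, hstay t q hq]
      omega
end

section
/- For every t ∈ ℕ and all p, q ∈ V, |ℓ_t p − ℓ_t q| ≤ d(p,q): the absolute value of the (intrinsic) delay between two processes never exceeds their distance in the network. -/
/-- A potential that varies by at most one along each edge varies along a walk by at most
the length of the walk. -/
theorem abs_sub_le_walk_length {V : Type*} {G : SimpleGraph V} {f : V → ℤ}
    (hf : ∀ p q, G.Adj p q → |f p - f q| ≤ 1) {p q : V} (w : G.Walk p q) :
    |f p - f q| ≤ (w.length : ℤ) := by
  induction w with
  | nil => simp
  | @cons u v x h w ih =>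
    have htri := abs_sub_le (f u) (f v) (f x)
    have hedge := hf u v h
    rw [SimpleGraph.Walk.length_cons]
    push_cast
    linarith

/-- Unison steps preserve the property that neighbouring clocks differ by at most one. -/
theorem abs_sub_le_one_of_adj {V : Type*} {G : SimpleGraph V} {ℓ : ℕ → V → ℤ} {A : ℕ → Set V}
    (hguard : ∀ t, ∀ p ∈ A t, ∀ q, G.Adj p q → ℓ t q = ℓ t p ∨ ℓ t q = ℓ t p + 1)
    (hfire : ∀ t, ∀ p ∈ A t, ℓ (t + 1) p = ℓ t p + 1)
    (hstay : ∀ t, ∀ p, p ∉ A t → ℓ (t + 1) p = ℓ t p)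
    (hinit : ∀ p q, G.Adj p q → |ℓ 0 p - ℓ 0 q| ≤ 1) (t : ℕ) :
    ∀ p q, G.Adj p q → |ℓ t p - ℓ t q| ≤ 1 := by
  induction t with
  | zero => exact hinit
  | succ t ih =>
    intro p q h
    have hpq := ih p q h
    rw [abs_le] at hpq ⊢
    by_cases hp : p ∈ A t <;> by_cases hq : q ∈ A t
    · rw [hfire t p hp, hfire t q hq]
      omega
    · have := hguard t p hp q h
      rw [hfire t p hp, hstay t q hq]
      omega
    · have := hguard t q hq p h.symm
      rw [hstay t p hp, hfire t q hq]
      omega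
    · rw [hstay t p hp, hstay t q hq]
      omega


/-- In every integer-lifted unison execution, for every time `t`
and all processes `p, q`, the absolute value of the (intrinsic) delay
`|ℓ_t p − ℓ_t q|` never exceeds the graph distance `d(p,q)`. -/
theorem stmt_8 {V : Type*} [Fintype V] (G : SimpleGraph V) (hconn : G.Connected)
    (ℓ : ℕ → V → ℤ) (A : ℕ → Set V)
    (hA : ∀ t, (A t).Nonempty)
    (hguard : ∀ t, ∀ p ∈ A t, ∀ q, G.Adj p q → ℓ t q = ℓ t p ∨ ℓ t q = ℓ t p + 1)
    (hfire : ∀ t, ∀ p ∈ A t, ℓ (t + 1) p = ℓ t p + 1)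
    (hstay : ∀ t, ∀ p, p ∉ A t → ℓ (t + 1) p = ℓ t p)
    (hinit : ∀ p q, G.Adj p q → |ℓ 0 p - ℓ 0 q| ≤ 1) :
    ∀ t, ∀ p q : V, |ℓ t p - ℓ t q| ≤ (G.dist p q : ℤ) := by
  intro t p q
  obtain ⟨w, hw⟩ := hconn.exists_walk_length_eq_dist p q
  rw [← hw]
  exact abs_sub_le_walk_length (abs_sub_le_one_of_adj hguard hfire hstay hinit t) w
end

section
/- For every p ∈ V and every α ∈ {1,…,ρ}, at time t_{p,U·δ+α} (just after the update performed at that event), the registers satisfy v₁(p) = ⨁ { v₀(q) : d(q,p) ≤ α−1 } and v₂(p) = ⨁ { v₀(q) : d(q,p) ≤ α }. In particular, at the cut C_{U·δ+ρ}, each register v₂(p) equals ⨁ { v₀(q) : q ∈ V(p,ρ) }, the infimum of v₀ over the ball of radius ρ around p (self-stabilizing computation of an infimum at distance ρ). -/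
namespace SimpleGraph

variable {V S : Type*} {G : SimpleGraph V}

/-- In a connected graph, a ball of radius `n + 1` is its centre together with the balls of
radius `n` around the neighbours of the centre. -/
theorem Connected.dist_le_succ_iff (hconn : G.Connected) {p q : V} {n : ℕ} :
    G.dist q p ≤ n + 1 ↔ q = p ∨ ∃ r, G.Adj p r ∧ G.dist q r ≤ n := by
  constructor
  · intro h
    obtain ⟨w, hw⟩ := hconn.exists_walk_length_eq_dist p q
    rw [dist_comm] at h
    cases w with
    | nil => exact Or.inl rfl
    | cons hadj w' =>
      refine Or.inr ⟨_, hadj, ?_⟩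
      rw [Walk.length_cons] at hw
      have := dist_le w'
      rw [dist_comm]
      omega
  · rintro (rfl | ⟨r, hadj, hr⟩)
    · simp
    · have := hconn.dist_triangle (u := q) (v := r) (w := p)
      have := dist_eq_one_iff_adj.2 hadj.symm
      omega

variable [Fintype V] [SemilatticeInf S] [OrderTop S]

theorem Connected.inf_filter_dist_le_zero (hconn : G.Connected) (v : V → S) (p : V) :
    (Finset.univ.filter (fun q : V => G.dist q p ≤ 0)).inf v = v p := by
  have : Finset.univ.filter (fun q : V => G.dist q p ≤ 0) = {p} := by
    ext q
    simp [hconn.dist_eq_zero_iff]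
  rw [this, Finset.inf_singleton]

theorem Connected.inf_filter_dist_le_succ [DecidableRel G.Adj] (hconn : G.Connected)
    (v : V → S) (p : V) (n : ℕ) :
    (Finset.univ.filter (fun q : V => G.dist q p ≤ n + 1)).inf v =
      v p ⊓ (G.neighborFinset p).inf
        (fun r => (Finset.univ.filter (fun q : V => G.dist q r ≤ n)).inf v) := by
  refine eq_of_forall_le_iff fun c => ?_
  simp only [Finset.le_inf_iff, le_inf_iff, Finset.mem_filter, Finset.mem_univ, true_and,
    mem_neighborFinset, hconn.dist_le_succ_iff]
  constructor
  · exact fun h => ⟨h p (Or.inl rfl), fun r hr q hq => h q (Or.inr ⟨r, hr, hq⟩)⟩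
  · rintro ⟨h₀, h⟩ q (rfl | ⟨r, hr, hq⟩)
    exacts [h₀, h r hr q hq]

end SimpleGraph

/-- With `δ = ρ + 1`, registers `v₁, v₂` initialized to `v₀(p)`
at time `t_{p,U·δ}` and updated at every firing `t → t+1` of `p` with
`U·δ ≤ ℓ_t p ≤ U·δ + ρ − 1` by `v₁(p) := v₂(p)` and
`v₂(p) := v₀(p) ⊕ ⨁_{q ∈ N(p)} w_q`, where `w_q = v₂(q)` if `ℓ_t q = ℓ_t p`
and `w_q = v₁(q)` if `ℓ_t q = ℓ_t p + 1` (registers unchanged at all other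
steps): for every `p ∈ V` and every `α ∈ {1,…,ρ}`, at time `t_{p,U·δ+α}` the
registers satisfy `v₁(p) = ⨁ { v₀(q) : d(q,p) ≤ α−1 }` and
`v₂(p) = ⨁ { v₀(q) : d(q,p) ≤ α }`.  In particular at the cut `C_{U·δ+ρ}`,
each `v₂(p)` equals `⨁ { v₀(q) : q ∈ V(p,ρ) }`, the infimum of `v₀` over the
ball of radius `ρ` around `p`. -/
theorem stmt_12 {V : Type*} [Fintype V] (G : SimpleGraph V)
    [DecidableRel G.Adj] (hconn : G.Connected)
    (ℓ : ℕ → V → ℤ) (A : ℕ → Set V)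
    (hA : ∀ t, (A t).Nonempty)
    (hguard : ∀ t, ∀ p ∈ A t, ∀ q, G.Adj p q → ℓ t q = ℓ t p ∨ ℓ t q = ℓ t p + 1)
    (hfire : ∀ t, ∀ p ∈ A t, ℓ (t + 1) p = ℓ t p + 1)
    (hstay : ∀ t, ∀ p, p ∉ A t → ℓ (t + 1) p = ℓ t p)
    (hinit : ∀ p q, G.Adj p q → |ℓ 0 p - ℓ 0 q| ≤ 1)
    (hfair : ∀ (p : V) (t : ℕ), ∃ t', t ≤ t' ∧ p ∈ A t')
    (ρ : ℕ) (hρ : 1 ≤ ρ)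
    (U : ℤ) (hU : ∀ p : V, ℓ 0 p ≤ U * (ρ + 1))
    (T : ℤ → V → ℕ)
    (hT : ∀ (m : ℤ) (p : V), U * (ρ + 1) ≤ m →
      ℓ (T m p) p = m ∧ ∀ t, ℓ t p = m → T m p ≤ t)
    {S : Type*} [SemilatticeInf S] [OrderTop S]
    (v₀ : V → S) (v₁ v₂ : ℕ → V → S)
    (hinit₁ : ∀ p : V, v₁ (T (U * (ρ + 1)) p) p = v₀ p)
    (hinit₂ : ∀ p : V, v₂ (T (U * (ρ + 1)) p) p = v₀ p)
    (hupd : ∀ (t : ℕ), ∀ p ∈ A t,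
      U * (ρ + 1) ≤ ℓ t p → ℓ t p ≤ U * (ρ + 1) + (ρ : ℤ) - 1 →
      v₁ (t + 1) p = v₂ t p ∧
      v₂ (t + 1) p = v₀ p ⊓ (G.neighborFinset p).inf
        (fun q => if ℓ t q = ℓ t p then v₂ t q else v₁ t q))
    (hsame : ∀ (t : ℕ) (p : V), T (U * (ρ + 1)) p ≤ t →
      ¬ (p ∈ A t ∧ U * (ρ + 1) ≤ ℓ t p ∧ ℓ t p ≤ U * (ρ + 1) + (ρ : ℤ) - 1) →
      v₁ (t + 1) p = v₁ t p ∧ v₂ (t + 1) p = v₂ t p) :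
    (∀ (p : V) (α : ℕ), 1 ≤ α → α ≤ ρ →
      v₁ (T (U * (ρ + 1) + α) p) p =
        (Finset.univ.filter (fun q : V => G.dist q p ≤ α - 1)).inf v₀ ∧
      v₂ (T (U * (ρ + 1) + α) p) p =
        (Finset.univ.filter (fun q : V => G.dist q p ≤ α)).inf v₀) ∧
    (∀ p : V, v₂ (T (U * (ρ + 1) + ρ) p) p =
      (Finset.univ.filter (fun q : V => G.dist q p ≤ ρ)).inf v₀) := by
  have hmono : ∀ p, Monotone fun t => ℓ t p := fun p => monotone_nat_of_le_succ fun t => by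
    by_cases hp : p ∈ A t
    · have := hfire t p hp
      omega
    · exact (hstay t p hp).ge
  generalize U * (ρ + 1) = B at *
  have key : ∀ (t : ℕ) (p : V) (α : ℕ), α ≤ ρ → ℓ t p = B + α →
      v₁ t p = (Finset.univ.filter (fun q : V => G.dist q p ≤ α - 1)).inf v₀ ∧
      v₂ t p = (Finset.univ.filter (fun q : V => G.dist q p ≤ α)).inf v₀ := by
    have base : ∀ (t : ℕ) (p : V), T B p = t →
        v₁ t p = (Finset.univ.filter (fun q : V => G.dist q p ≤ 0 - 1)).inf v₀ ∧
        v₂ t p = (Finset.univ.filter (fun q : V => G.dist q p ≤ 0)).inf v₀ := by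
      rintro t p rfl
      rw [Nat.zero_sub, hconn.inf_filter_dist_le_zero]
      exact ⟨hinit₁ p, hinit₂ p⟩
    intro t
    induction t with
    | zero =>
      intro p α _ hα
      have h0 := hU p
      obtain rfl : α = 0 := by omega
      exact base 0 p (Nat.le_zero.1 ((hT B p le_rfl).2 0 (by simpa using hα)))
    | succ t ih =>
      intro p α hαρ hα
      by_cases hp : p ∈ A t
      · have hl := hfire t p hp
        cases α with
        | zero =>
          refine base _ p (le_antisymm ((hT B p le_rfl).2 _ (by simpa using hα)) ?_)
          by_contra! hlt
          have h1 : ℓ (T B p) p ≤ ℓ t p := hmono p (Nat.lt_succ_iff.1 hlt)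
          rw [(hT B p le_rfl).1] at h1
          omega
        | succ α =>
          have hp' : ℓ t p = B + α := by
            push_cast at hα
            omega
          obtain ⟨h1, h2⟩ := hupd t p hp (by omega) (by omega)
          refine ⟨h1.trans (ih p α (by omega) hp').2, ?_⟩
          rw [h2, hconn.inf_filter_dist_le_succ]
          congr 1
          refine Finset.inf_congr rfl fun q hq => ?_
          split_ifs with hqp
          · exact (ih q α (by omega) (hqp.trans hp')).2
          · have hq' := (hguard t p hp q ((G.mem_neighborFinset p q).1 hq)).resolve_left hqp
            exact (ih q (α + 1) hαρ (by push_cast; omega)).1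
      · rw [hstay t p hp] at hα
        have hTt : T B p ≤ t := by
          by_contra! hlt
          have h1 : ℓ t p ≤ ℓ (T B p) p := hmono p hlt.le
          have hB := (hT B p le_rfl).1
          have := (hT B p le_rfl).2 t (by omega)
          omega
        obtain ⟨h1, h2⟩ := hsame t p hTt fun h => hp h.1
        rw [h1, h2]
        exact ih p α hαρ hα
  have main := fun (p : V) (α : ℕ) (hα : α ≤ ρ) =>
    key (T (B + α) p) p α hα (hT (B + α) p (by omega)).1
  exact ⟨fun p α _ hα => main p α hα, fun p => (main p ρ le_rfl).2⟩
end

section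
/- For every p ∈ V: Λ_p is a finite nonempty set; eval(μ) ≥_⊕ ⨁Λ_p for every walk μ ending at p; and Λ_p ⊆ Λ'_p. Consequently ⨁Λ'_p exists and equals ⨁Λ_p, i.e. ⨁Λ_p is the greatest lower bound of the (possibly infinite) set Λ'_p with respect to ≤_⊕. -/
/-- Evaluation of the `r`-operators along a walk, starting from value `x` at
vertex `p`. -/
def evalFrom {V S : Type*} (r : V → V → S → S) : S → V → List V → S
  | x, _, [] => x
  | x, p, q :: rest => evalFrom r (r p q x) q rest

/-- `eval(p₀p₁…p_n) = (r_{p_{n−1},p_n} ∘ ⋯ ∘ r_{p₀,p₁})(v₀(p₀))`. -/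
def evalWalk {V S : Type*} [SemilatticeInf S] [OrderTop S]
    (r : V → V → S → S) (v₀ : V → S) : List V → S
  | [] => ⊤
  | p :: rest => evalFrom r (v₀ p) p rest

theorem evalFrom_append_cons {V S : Type*} (r : V → V → S → S) (x : S) (p q : V)
    (s t : List V) :
    evalFrom r x p (s ++ q :: t) = evalFrom r (evalFrom r x p (s ++ [q])) q t := by
  induction s generalizing x p with
  | nil => rfl
  | cons a s ih => exact ih (r p a x) a

section EvalFrom

variable {V S : Type*} [SemilatticeInf S] {R : V → V → Prop} {r : V → V → S → S}

theorem evalFrom_mono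
    (hinf : ∀ u v : V, R u v → ∀ x y : S, r u v (x ⊓ y) = r u v x ⊓ r u v y)
    {x y : S} {p : V} {l : List V} (hl : (p :: l).IsChain R) (hxy : x ≤ y) :
    evalFrom r x p l ≤ evalFrom r y p l := by
  induction l generalizing x y p with
  | nil => exact hxy
  | cons q l ih =>
    rw [List.isChain_cons_cons] at hl
    refine ih hl.2 ?_
    rw [← inf_eq_left, ← hinf p q hl.1, inf_eq_left.mpr hxy]

theorem le_evalFrom (hle : ∀ u v : V, R u v → ∀ x : S, x ≤ r u v x)
    {x : S} {p : V} {l : List V} (hl : (p :: l).IsChain R) :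
    x ≤ evalFrom r x p l := by
  induction l generalizing x p with
  | nil => exact le_rfl
  | cons q l ih =>
    rw [List.isChain_cons_cons] at hl
    exact (hle p q hl.1 x).trans (ih hl.2)

/-- Cutting out circular subwalks turns a walk into a simple walk with the same endpoints whose
evaluation is at most that of the original walk. -/
theorem exists_nodup_evalFrom_le
    (hinf : ∀ u v : V, R u v → ∀ x y : S, r u v (x ⊓ y) = r u v x ⊓ r u v y)
    (hle : ∀ u v : V, R u v → ∀ x : S, x ≤ r u v x)
    (x : S) {p : V} {l : List V} (hl : (p :: l).IsChain R) :
    ∃ t : List V, (p :: t).IsChain R ∧ (p :: t).Nodup ∧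
      (p :: t).getLast? = (p :: l).getLast? ∧ evalFrom r x p t ≤ evalFrom r x p l := by
  induction l generalizing x p with
  | nil => exact ⟨[], hl, by simp, rfl, le_rfl⟩
  | cons q l ih =>
    have hpq := List.isChain_cons_cons.mp hl
    obtain ⟨t, ht, hnodup, hlast, heval⟩ := ih (r p q x) hpq.2
    have hpt : (p :: q :: t).IsChain R := List.isChain_cons_cons.mpr ⟨hpq.1, ht⟩
    rw [List.getLast?_cons_cons, ← hlast]
    by_cases hp : p ∈ q :: t
    · obtain ⟨s, t', hst⟩ := List.append_of_mem hp
      change evalFrom r x p (q :: t) ≤ evalFrom r x p (q :: l) at heval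
      rw [hst] at hnodup hpt heval ⊢
      have htail : (p :: t').IsChain R := hpt.suffix ⟨p :: s, rfl⟩
      have hloop : (p :: (s ++ [p])).IsChain R := hpt.prefix ⟨t', by simp⟩
      refine ⟨t', htail, hnodup.sublist (List.sublist_append_right _ _),
        (List.getLast?_append_cons _ _ _).symm, ?_⟩
      rw [evalFrom_append_cons] at heval
      exact (evalFrom_mono hinf htail (le_evalFrom hle hloop)).trans heval
    · exact ⟨q :: t, hpt, List.nodup_cons.mpr ⟨hp, hnodup⟩, List.getLast?_cons_cons, heval⟩

end EvalFrom

theorem finite_setOf_list_nodup (V : Type*) [Finite V] : {m : List V | m.Nodup}.Finite := by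
  classical
  have := Fintype.ofFinite V
  exact Set.finite_coe_iff.mp (Finite.of_fintype {m : List V // m.Nodup})

/-- For every `p ∈ V`, with
`Λ_p = {eval(μ) : μ a simple walk ending at p}` and
`Λ'_p = {eval(μ) : μ any walk ending at p}`:
`Λ_p` is finite and nonempty; every lower bound situation works out so that
`eval(μ) ≥_⊕ ⨁Λ_p` for every walk `μ` ending at `p`; `Λ_p ⊆ Λ'_p`; and
`⨁Λ'_p` exists and equals `⨁Λ_p`, i.e. `⨁Λ_p` is the greatest lower bound of
the (possibly infinite) set `Λ'_p` for `≤_⊕`. -/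
theorem stmt_13 {V : Type*} [Fintype V] (G : SimpleGraph V)
    {S : Type*} [SemilatticeInf S] [OrderTop S]
    (r : V → V → S → S)
    (hend : ∀ u v : V, (u = v ∨ G.Adj u v) → ∀ x y : S, r u v (x ⊓ y) = r u v x ⊓ r u v y)
    (hidem : ∀ u v : V, (u = v ∨ G.Adj u v) → ∀ x : S, x ≤ r u v x)
    (hid : ∀ (u : V) (x : S), r u u x = x)
    (v₀ : V → S) (p : V) :
    (evalWalk r v₀ '' {m | IsWalk G m ∧ m.Nodup ∧ m.getLast? = some p}).Finite ∧
    (evalWalk r v₀ '' {m | IsWalk G m ∧ m.Nodup ∧ m.getLast? = some p}).Nonempty ∧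
    (evalWalk r v₀ '' {m | IsWalk G m ∧ m.Nodup ∧ m.getLast? = some p}) ⊆
      (evalWalk r v₀ '' {m | IsWalk G m ∧ m.getLast? = some p}) ∧
    ∀ a : S,
      IsGLB (evalWalk r v₀ '' {m | IsWalk G m ∧ m.Nodup ∧ m.getLast? = some p}) a →
      ((∀ m : List V, IsWalk G m → m.getLast? = some p → a ≤ evalWalk r v₀ m) ∧
        IsGLB (evalWalk r v₀ '' {m | IsWalk G m ∧ m.getLast? = some p}) a) := by
  have hsub : (evalWalk r v₀ '' {m | IsWalk G m ∧ m.Nodup ∧ m.getLast? = some p}) ⊆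
      (evalWalk r v₀ '' {m | IsWalk G m ∧ m.getLast? = some p}) :=
    Set.image_mono fun m hm => ⟨hm.1, hm.2.2⟩
  refine ⟨((finite_setOf_list_nodup V).subset fun m hm => hm.2.1).image _,
    ⟨_, [p], ⟨⟨by simp, List.isChain_singleton p⟩, by simp, rfl⟩, rfl⟩, hsub, fun a ha => ?_⟩
  have hlb : ∀ m : List V, IsWalk G m → m.getLast? = some p → a ≤ evalWalk r v₀ m := by
    rintro (_ | ⟨q, l⟩) hm hlast
    · exact absurd rfl hm.1
    · obtain ⟨t, ht, hnodup, htlast, heval⟩ :=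
        exists_nodup_evalFrom_le hend hidem (v₀ q) hm.2
      exact (ha.1 ⟨q :: t, ⟨⟨by simp, ht⟩, hnodup, htlast.trans hlast⟩, rfl⟩).trans heval
  refine ⟨hlb, ?_, fun b hb => ha.2 fun y hy => hb (hsub hy)⟩
  rintro _ ⟨m, hm, rfl⟩
  exact hlb m hm.1 hm.2
end

section
/- Let G be a finite simple graph and r : V → ℤ a configuration such that d_K(r(p), r(q)) ≤ 1 for every edge {p,q} (neighboring clock values are locally comparable). For a walk μ = p_0 p_1 … p_k in G, define the delay Δ_μ = Σ_{i=0}^{k−1} ( r(p_{i+1}) ⊖ r(p_i) ). Then Δ_μ ≡ r(p_k) − r(p_0) (mod K) and |Δ_μ| ≤ k. In particular, if the delay is intrinsic (Δ_μ depends only on the endpoints of μ), then the absolute value of the delay between any two processes p and q is at most their graph distance d(p,q). -/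
/-- `b ⊖ a`: for locally comparable `a, b`, `(b−a) mod K` if `a ≤_l b`
(i.e. `(b−a) mod K ≤ 1`), and `−((a−b) mod K)` otherwise. -/
def ominus (K : ℕ) (b a : ℤ) : ℤ :=
  if (b - a) % (K : ℤ) ≤ 1 then (b - a) % (K : ℤ) else -((a - b) % (K : ℤ))

/-- The delay `Δ_μ = Σ_{i=0}^{k−1} ( r(p_{i+1}) ⊖ r(p_i) )` of a walk
`μ = p₀p₁…p_k`, given clock values `r`. -/
def delay {V : Type*} (K : ℕ) (r : V → ℤ) : List V → ℤ
  | [] => 0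
  | [_] => 0
  | a :: b :: rest => ominus K (r b) (r a) + delay K r (b :: rest)

theorem ominus_modEq (K : ℕ) (b a : ℤ) : ominus K b a ≡ b - a [ZMOD (K : ℤ)] := by
  unfold ominus
  split_ifs
  · exact Int.mod_modEq _ _
  · simpa using (Int.mod_modEq (a - b) K).neg

theorem abs_ominus_le_one {K : ℕ} (hK : K ≠ 0) {a b : ℤ}
    (h : min ((a - b) % (K : ℤ)) ((b - a) % (K : ℤ)) ≤ 1) : |ominus K b a| ≤ 1 := by
  have hK' : (K : ℤ) ≠ 0 := by exact_mod_cast hK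
  have h₁ := Int.emod_nonneg (a - b) hK'
  have h₂ := Int.emod_nonneg (b - a) hK'
  rw [min_le_iff] at h
  unfold ominus
  split_ifs <;> rw [abs_le] <;> omega

theorem delay_modEq {V : Type*} (K : ℕ) (r : V → ℤ) (μ : List V) (p q : V)
    (hp : μ.head? = some p) (hq : μ.getLast? = some q) :
    delay K r μ ≡ r q - r p [ZMOD (K : ℤ)] := by
  induction μ generalizing p with
  | nil => simp at hp
  | cons a l ih =>
    obtain rfl : a = p := by simpa using hp
    cases l with
    | nil =>
      obtain rfl : a = q := by simpa using hq
      simp [delay]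
    | cons b l =>
      have h := (ominus_modEq K (r b) (r a)).add (ih b rfl (by simpa using hq))
      rwa [show r b - r a + (r q - r b) = r q - r a by ring] at h

theorem abs_delay_le {V : Type*} {G : SimpleGraph V} {K : ℕ} (hK : K ≠ 0) {r : V → ℤ}
    (hloc : ∀ p q : V, G.Adj p q →
      min ((r p - r q) % (K : ℤ)) ((r q - r p) % (K : ℤ)) ≤ 1)
    {μ : List V} (hμ : IsWalk G μ) : |delay K r μ| ≤ (μ.length : ℤ) - 1 := by
  obtain ⟨hne, hchain⟩ := hμ
  induction μ with
  | nil => exact absurd rfl hne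
  | cons a l ih =>
    cases l with
    | nil => simp [delay]
    | cons b l =>
      obtain ⟨hab, hl⟩ := List.isChain_cons_cons.1 hchain
      have h₁ : |ominus K (r b) (r a)| ≤ 1 := by
        refine abs_ominus_le_one hK ?_
        rcases hab with rfl | hab
        · simp
        · exact hloc a b hab
      have h₂ := ih (List.cons_ne_nil b l) hl
      calc |delay K r (a :: b :: l)| ≤ |ominus K (r b) (r a)| + |delay K r (b :: l)| :=
            abs_add_le _ _
        _ ≤ _ := by
            simp only [List.length_cons, Nat.cast_add, Nat.cast_one] at h₂ ⊢
            linarith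

theorem isWalk_support {V : Type*} {G : SimpleGraph V} {p q : V} (w : G.Walk p q) :
    IsWalk G w.support :=
  ⟨w.support_ne_nil, w.isChain_adj_support.imp fun _ _ => Or.inr⟩

/-- Let `r : V → ℤ` be a configuration with
`d_K(r(p), r(q)) ≤ 1` for every edge `{p,q}` (neighboring clock values locally
comparable).  Then for every walk `μ = p₀p₁…p_k`,
`Δ_μ ≡ r(p_k) − r(p₀) (mod K)` and `|Δ_μ| ≤ k`.  In particular, if the delay
is intrinsic (`Δ_μ` depends only on the endpoints of `μ`), then the absolute
value of the delay between any two processes is at most their graph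
distance. -/
theorem stmt_19 {V : Type*} [Fintype V] (G : SimpleGraph V) (hconn : G.Connected)
    (K : ℕ) (hK : 2 ≤ K) (r : V → ℤ)
    (hloc : ∀ p q : V, G.Adj p q →
      min ((r p - r q) % (K : ℤ)) ((r q - r p) % (K : ℤ)) ≤ 1) :
    (∀ μ : List V, IsWalk G μ → ∀ p₀ pk : V,
      μ.head? = some p₀ → μ.getLast? = some pk →
        delay K r μ ≡ r pk - r p₀ [ZMOD (K : ℤ)] ∧
        |delay K r μ| ≤ (μ.length : ℤ) - 1) ∧
    ((∀ μ μ' : List V, IsWalk G μ → IsWalk G μ' →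
        μ.head? = μ'.head? → μ.getLast? = μ'.getLast? →
        delay K r μ = delay K r μ') →
      ∀ (μ : List V) (p q : V), IsWalk G μ →
        μ.head? = some p → μ.getLast? = some q →
        |delay K r μ| ≤ (G.dist p q : ℤ)) := by
  have hK₀ : K ≠ 0 := by omega
  refine ⟨fun μ hμ p q hp hq => ⟨delay_modEq K r μ p q hp hq, abs_delay_le hK₀ hloc hμ⟩,
    fun hint μ p q hμ hp hq => ?_⟩
  obtain ⟨w, hw⟩ := hconn.exists_walk_length_eq_dist p q
  have hhead : w.support.head? = some p := by
    rw [List.head?_eq_some_head w.support_ne_nil, w.head_support]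
  have hlast : w.support.getLast? = some q := by
    rw [List.getLast?_eq_some_getLast w.support_ne_nil, w.getLast_support]
  rw [hint μ w.support hμ (isWalk_support w) (hp.trans hhead.symm) (hq.trans hlast.symm), ← hw]
  simpa [SimpleGraph.Walk.length_support] using abs_delay_le hK₀ hloc (isWalk_support w)
end
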